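/- arXiv:1912.05390 — 4 statements merged into one kernel-verified Lean document; each statement's English description precedes it below -/
import Mathlib

section
/- Let G = (V, E) be a finite simple graph, let δ > 0, let n ≥ 1 be real, and let i ≥ 5 be an integer. Let v ∈ V, let X(v) = {{u,v} ∈ E : d(u) ≤ d(v)}, and let E* ⊆ E. Assume: (a) every node w satisfies d_{E*}(w) ≤ 2·n^{(4−i)δ}·d(w) + n^{3δ}; (b) |X(v) ∩ E*| ≥ (2/3)·n^{(4−i)δ}·|X(v)|; (c) d(v) ≥ n^{(i−1)δ}; and (d) |X(v)| ≥ d(v)/3. Then either v is incident to an edge of E* whose degree in E* is 0, or ∑_{{u,v} ∈ E*} 1/d_{E*}({u,v}) ≥ 1/27. -/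
variable {V : Type*} [Fintype V] [DecidableEq V]

/-- `d_{E'}(w)`: the number of edges of `E'` incident to the node `w`. -/
def edgeSetDegV (Estar : Finset (Sym2 V)) (w : V) : ℕ :=
  (Estar.filter (fun e => w ∈ e)).card

/-- `d_{E'}(e)`: the number of edges of `E'` other than `e` sharing an endpoint with `e`. -/
def edgeSetDegE (Estar : Finset (Sym2 V)) (e : Sym2 V) : ℕ :=
  (Estar.filter (fun e' => e' ≠ e ∧ ∃ w : V, w ∈ e ∧ w ∈ e')).card

/-- `X(v)`: the edges `{u,v}` of `G` with `d(u) ≤ d(v)`. -/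
def loserEdges (G : SimpleGraph V) [DecidableRel G.Adj] (v : V) : Finset (Sym2 V) :=
  G.edgeFinset.filter (fun e => v ∈ e ∧ ∀ u : V, u ∈ e → G.degree u ≤ G.degree v)

theorem edgeSetDegE_mk_le (Estar : Finset (Sym2 V)) (v u : V) :
    edgeSetDegE Estar s(v, u) ≤ edgeSetDegV Estar v + edgeSetDegV Estar u := by
  unfold edgeSetDegE edgeSetDegV
  refine (Finset.card_le_card ?_).trans (Finset.card_union_le _ _)
  intro e he
  simp only [Finset.mem_filter, Finset.mem_union, Sym2.mem_iff] at he ⊢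
  obtain ⟨heE, -, w, rfl | rfl, hw⟩ := he
  · exact Or.inl ⟨heE, hw⟩
  · exact Or.inr ⟨heE, hw⟩

/-- Under the sparsification invariants (with the `(1 ± o(1))` factors
instantiated as `2` and `2/3`), every good node `v` either is incident to an edge of `E*`
of degree `0` in `E*`, or satisfies `∑_{{u,v} ∈ E*} 1/d_{E*}({u,v}) ≥ 1/27`. -/
theorem good_node_inv_edge_degree_sum
    (G : SimpleGraph V) [DecidableRel G.Adj]
    (δ : ℝ) (hδ : 0 < δ) (n : ℝ) (hn : 1 ≤ n) (i : ℕ) (hi : 5 ≤ i)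
    (v : V) (Estar : Finset (Sym2 V)) (hE : Estar ⊆ G.edgeFinset)
    (ha : ∀ w : V, (edgeSetDegV Estar w : ℝ) ≤
        2 * n ^ ((4 - (i : ℝ)) * δ) * G.degree w + n ^ (3 * δ))
    (hb : (2 / 3 : ℝ) * n ^ ((4 - (i : ℝ)) * δ) * (loserEdges G v).card ≤
        ((loserEdges G v ∩ Estar).card : ℝ))
    (hc : n ^ (((i : ℝ) - 1) * δ) ≤ (G.degree v : ℝ))
    (hd : (G.degree v : ℝ) / 3 ≤ ((loserEdges G v).card : ℝ)) :
    (∃ e ∈ Estar, v ∈ e ∧ edgeSetDegE Estar e = 0) ∨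
      (1 / 27 : ℝ) ≤
        ∑ e ∈ Estar.filter (fun e => v ∈ e), 1 / (edgeSetDegE Estar e : ℝ) := by
  rw [or_iff_not_imp_left]
  intro hzero
  have hn0 : 0 < n := by linarith
  set p : ℝ := n ^ ((4 - (i : ℝ)) * δ) with hp
  set D : ℝ := (G.degree v : ℝ) with hD
  have hp0 : 0 < p := Real.rpow_pos_of_pos hn0 _
  have hD0 : 0 < D := (Real.rpow_pos_of_pos hn0 _).trans_le hc
  have hpD : 0 < p * D := mul_pos hp0 hD0
  have hn3 : n ^ (3 * δ) ≤ p * D := by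
    calc n ^ (3 * δ) = p * n ^ (((i : ℝ) - 1) * δ) := by
          rw [hp, ← Real.rpow_add hn0]
          ring_nf
      _ ≤ p * D := by gcongr
  have hdeg : ∀ w : V, G.degree w ≤ G.degree v → (edgeSetDegV Estar w : ℝ) ≤ 3 * (p * D) := by
    intro w hw
    have hwD : (G.degree w : ℝ) ≤ D := Nat.cast_le.mpr hw
    have := ha w
    have := mul_le_mul_of_nonneg_left hwD hp0.le
    linarith
  have hterm : ∀ e ∈ loserEdges G v ∩ Estar,
      1 / (6 * (p * D)) ≤ 1 / (edgeSetDegE Estar e : ℝ) := by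
    intro e he
    simp only [loserEdges, Finset.mem_inter, Finset.mem_filter] at he
    obtain ⟨⟨-, hve, hle⟩, heE⟩ := he
    have hpos : 0 < edgeSetDegE Estar e :=
      Nat.pos_of_ne_zero fun h => hzero ⟨e, heE, hve, h⟩
    obtain ⟨u, rfl⟩ := Sym2.mem_iff_exists.mp hve
    refine one_div_le_one_div_of_le (by exact_mod_cast hpos) ?_
    have h : (edgeSetDegE Estar s(v, u) : ℝ) ≤ edgeSetDegV Estar v + edgeSetDegV Estar u := by
      exact_mod_cast edgeSetDegE_mk_le Estar v u
    have hv := hdeg v le_rfl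
    have hu := hdeg u (hle u (Sym2.mem_mk_right v u))
    linarith
  have hcard : 2 / 9 * (p * D) ≤ ((loserEdges G v ∩ Estar).card : ℝ) := by
    have := mul_le_mul_of_nonneg_left hd hp0.le
    linarith
  calc (1 / 27 : ℝ) = 2 / 9 * (p * D) * (1 / (6 * (p * D))) := by
        field_simp
        norm_num
    _ ≤ (loserEdges G v ∩ Estar).card * (1 / (6 * (p * D))) := by gcongr
    _ = (loserEdges G v ∩ Estar).card • (1 / (6 * (p * D))) := (nsmul_eq_mul _ _).symm
    _ ≤ ∑ e ∈ loserEdges G v ∩ Estar, 1 / (edgeSetDegE Estar e : ℝ) :=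
        Finset.card_nsmul_le_sum _ _ _ hterm
    _ ≤ ∑ e ∈ Estar.filter (fun e => v ∈ e), 1 / (edgeSetDegE Estar e : ℝ) := by
        refine Finset.sum_le_sum_of_subset_of_nonneg ?_ fun _ _ _ => by positivity
        intro e he
        simp only [loserEdges, Finset.mem_inter, Finset.mem_filter] at he ⊢
        exact ⟨he.2, he.1.2.1⟩
end

section
/- Let G = (V, E) be a finite simple graph with |V| ≤ n, where n ≥ 100 is an integer, and let E* ⊆ E. Let (z_e)_{e ∈ E*} be pairwise independent random variables, each uniformly distributed on {1, …, n³}, and define E_h = {e ∈ E* : z_e < z_{e'} for every e' ∈ E* adjacent to e}. Let v ∈ V be a node such that either v is incident to an edge of E* whose degree in E* is 0, or ∑_{{u,v} ∈ E*} 1/d_{E*}({u,v}) ≥ 1/27. Then the probability that exactly one edge of E_h is incident to v (i.e., d_{E_h}(v) = 1) is at least 1/109. -/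
open MeasureTheory ProbabilityTheory

variable {V : Type*} [Fintype V] [DecidableEq V]

/-- A variable uniform on `{1, …, N}` is at most `K ≤ N` with probability `K / N`. -/
lemma measureReal_le_of_uniform {Ω : Type*} [MeasurableSpace Ω] (μ : Measure Ω)
    [IsProbabilityMeasure μ] {N : ℕ} (hN : 0 < N) {X : Ω → ℕ} (hX : Measurable X)
    (hunif : ∀ j ∈ Finset.Icc 1 N, μ {ω | X ω = j} = (N : ENNReal)⁻¹) {K : ℕ} (hK : K ≤ N) :
    μ.real {ω | X ω ≤ K} = K / N := by
  have key : ∀ s ⊆ Finset.Icc 1 N, μ.real {ω | X ω ∈ s} = s.card / N := by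
    intro s hs
    have hunion : {ω | X ω ∈ s} = ⋃ j ∈ s, {ω | X ω = j} := by ext; simp
    rw [hunion, measureReal_biUnion_finset]
    · rw [Finset.sum_congr rfl (g := fun _ => (N : ℝ)⁻¹)]
      · simp [div_eq_mul_inv]
      · intro j hj
        simp [measureReal_def, hunif j (hs hj)]
    · intro i _ j _ hij
      exact Set.disjoint_left.2 fun ω hi hj => hij (hi.symm.trans hj)
    · exact fun j _ => hX (measurableSet_singleton j)
  have hN' : (0 : ℝ) < N := by exact_mod_cast hN
  apply le_antisymm
  · have hc := probReal_compl_eq_one_sub (μ := μ) (s := {ω | X ω ≤ K}) (hX measurableSet_Iic)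
    have hge : μ.real {ω | X ω ∈ Finset.Icc (K + 1) N} ≤ μ.real {ω | X ω ≤ K}ᶜ := by
      refine measureReal_mono ?_
      intro ω hω
      exact fun h : X ω ≤ K => absurd (Finset.mem_Icc.1 (show X ω ∈ Finset.Icc (K + 1) N from hω)).1 (by omega)
    rw [hc, key _ (Finset.Icc_subset_Icc_left (by omega)), Nat.card_Icc,
      show N + 1 - (K + 1) = N - K by omega, Nat.cast_sub hK, sub_div, div_self hN'.ne'] at hge
    linarith
  · have hle : μ.real {ω | X ω ∈ Finset.Icc 1 K} ≤ μ.real {ω | X ω ≤ K} := by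
      refine measureReal_mono ?_
      intro ω hω
      exact (Finset.mem_Icc.1 (show X ω ∈ Finset.Icc 1 K from hω)).2
    rwa [key _ (Finset.Icc_subset_Icc_right hK), Nat.card_Icc, Nat.add_sub_cancel] at hle

/-- Thresholding at `K`: if `z i ≤ K < z j` for all `j ∈ s`, then `z i` is the strict minimum. -/
lemma measureReal_strictMin_ge {ι Ω : Type*} [MeasurableSpace Ω] (μ : Measure Ω)
    [IsProbabilityMeasure μ] (z : ι → Ω → ℕ) (s : Finset ι) (i : ι) (K : ℕ) {p : ℝ}
    (hi : μ.real {ω | z i ω ≤ K} = p) (hs : ∀ j ∈ s, μ.real {ω | z j ω ≤ K} = p)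
    (hindep : ∀ j ∈ s, IndepFun (z i) (z j) μ) :
    p - s.card * p ^ 2 ≤ μ.real {ω | ∀ j ∈ s, z i ω < z j ω} := by
  have hpair : ∀ j ∈ s, μ.real ({ω | z i ω ≤ K} ∩ {ω | z j ω ≤ K}) = p ^ 2 := by
    intro j hj
    have h := (hindep j hj).measure_inter_preimage_eq_mul (Set.Iic K) (Set.Iic K)
      measurableSet_Iic measurableSet_Iic
    calc μ.real ({ω | z i ω ≤ K} ∩ {ω | z j ω ≤ K})
        = μ.real {ω | z i ω ≤ K} * μ.real {ω | z j ω ≤ K} := by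
          rw [measureReal_def, measureReal_def, measureReal_def, ← ENNReal.toReal_mul]
          exact congrArg _ h
      _ = p ^ 2 := by rw [hi, hs j hj, sq]
  have hcover : {ω | z i ω ≤ K} ⊆ {ω | ∀ j ∈ s, z i ω < z j ω} ∪
      ⋃ j ∈ s, ({ω | z i ω ≤ K} ∩ {ω | z j ω ≤ K}) := by
    intro ω hω
    by_cases h : ∀ j ∈ s, z i ω < z j ω
    · exact Or.inl h
    · push Not at h
      obtain ⟨j, hj, hle⟩ := h
      exact Or.inr (Set.mem_biUnion hj ⟨hω, hle.trans hω⟩)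
  have hle := (measureReal_mono hcover (μ := μ)).trans (measureReal_union_le _ _)
  have hsum := measureReal_biUnion_finset_le (μ := μ) s
    (fun j => {ω | z i ω ≤ K} ∩ {ω | z j ω ≤ K})
  rw [Finset.sum_congr rfl hpair, Finset.sum_const, nsmul_eq_mul] at hsum
  linarith

/-- The threshold `⌊N / (2 d)⌋` almost maximizes `p - d p²` at `p = K / N`. -/
lemma threshold_bound {n d : ℕ} (hn : 100 ≤ n) (hd : 0 < d) (hdn : d ≤ n ^ 2) :
    (27 / 109 : ℝ) * (1 / d) ≤ ((n ^ 3 / (2 * d) : ℕ) : ℝ) / (n ^ 3 : ℕ) -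
      d * (((n ^ 3 / (2 * d) : ℕ) : ℝ) / (n ^ 3 : ℕ)) ^ 2 := by
  set K := n ^ 3 / (2 * d) with hK
  have hmod : 2 * d * K + n ^ 3 % (2 * d) = n ^ 3 := Nat.div_add_mod _ _
  have hlt : n ^ 3 % (2 * d) < 2 * d := Nat.mod_lt _ (by omega)
  set r := n ^ 3 % (2 * d)
  have hN : 0 < n ^ 3 := by positivity
  have hnd : 100 * d ≤ n ^ 3 := by nlinarith
  set N := n ^ 3
  have hm : (2 * d * K + r : ℝ) = N := by exact_mod_cast hmod
  have hr : (r : ℝ) < 2 * d := by exact_mod_cast hlt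
  have hnd' : (100 * d : ℝ) ≤ N := by exact_mod_cast hnd
  have hd' : (0 : ℝ) < d := by exact_mod_cast hd
  have hN' : (0 : ℝ) < N := by exact_mod_cast hN
  have hr0 : (0 : ℝ) ≤ r := by positivity
  have hK' : (K : ℝ) = (N - r) / (2 * d) := by field_simp; linarith
  have hform : (K : ℝ) / N - d * (K / N) ^ 2 = (1 / 4) * (1 / d) * (1 - (r / N) ^ 2) := by
    rw [hK']; field_simp; ring
  have hrN : (r : ℝ) / N ≤ 1 / 50 := by rw [div_le_iff₀ hN']; linarith
  have hrN0 : 0 ≤ (r : ℝ) / N := by positivity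
  have hsq : ((r : ℝ) / N) ^ 2 ≤ 1 / 109 := by nlinarith
  rw [hform]
  have : 0 < 1 / (d : ℝ) := by positivity
  nlinarith

/-- With pairwise independent labels `z_e` uniform on `{1, …, n³}` and
`E_h` the set of edges of `E*` that beat all their neighbors in `E*`, every node `v`
that is incident to an edge of `E*` of degree `0`, or satisfies
`∑_{{u,v} ∈ E*} 1/d_{E*}({u,v}) ≥ 1/27`, has `P(d_{E_h}(v) = 1) ≥ 1/109`. -/
theorem matched_with_constant_probability
    (G : SimpleGraph V) [DecidableRel G.Adj]
    (n : ℕ) (hn : 100 ≤ n) (hV : Fintype.card V ≤ n)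
    {Ω : Type*} [MeasurableSpace Ω] (μ : Measure Ω) [IsProbabilityMeasure μ]
    (Estar : Finset (Sym2 V)) (hE : Estar ⊆ G.edgeFinset)
    (z : Sym2 V → Ω → ℕ)
    (hmeas : ∀ e ∈ Estar, Measurable (z e))
    (huniform : ∀ e ∈ Estar, ∀ j ∈ Finset.Icc 1 (n ^ 3),
      μ {ω | z e ω = j} = ((n ^ 3 : ℕ) : ENNReal)⁻¹)
    (hindep : ∀ e ∈ Estar, ∀ e' ∈ Estar, e ≠ e' → IndepFun (z e) (z e') μ)
    (v : V)
    (hv : (∃ e ∈ Estar, v ∈ e ∧ edgeSetDegE Estar e = 0) ∨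
      (1 / 27 : ℝ) ≤
        ∑ e ∈ Estar.filter (fun e => v ∈ e), 1 / (edgeSetDegE Estar e : ℝ)) :
    (109 : ENNReal)⁻¹ ≤
      μ {ω | (Estar.filter (fun e => v ∈ e ∧ ∀ e' ∈ Estar,
          (e' ≠ e ∧ ∃ w : V, w ∈ e ∧ w ∈ e') → z e ω < z e' ω)).card = 1} := by
  set W : Sym2 V → Set Ω := fun e => {ω | ∀ e' ∈ Estar,
    (e' ≠ e ∧ ∃ w : V, w ∈ e ∧ w ∈ e') → z e ω < z e' ω} with hW
  have hsubset : (⋃ e ∈ Estar.filter (fun e => v ∈ e), W e) ⊆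
      {ω | (Estar.filter (fun e => v ∈ e ∧ ∀ e' ∈ Estar,
          (e' ≠ e ∧ ∃ w : V, w ∈ e ∧ w ∈ e') → z e ω < z e' ω)).card = 1} := by
    intro ω hω
    simp only [Set.mem_iUnion, Finset.mem_filter, exists_prop] at hω
    obtain ⟨e, ⟨he, hve⟩, hmin⟩ := hω
    refine Finset.card_eq_one.2 ⟨e, Finset.eq_singleton_iff_unique_mem.2
      ⟨Finset.mem_filter.2 ⟨he, hve, hmin⟩, fun f hf => ?_⟩⟩
    obtain ⟨hf, hvf, hfmin⟩ := Finset.mem_filter.1 hf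
    by_contra hne
    exact lt_asymm (hmin f hf ⟨hne, v, hve, hvf⟩) (hfmin e he ⟨Ne.symm hne, v, hvf, hve⟩)
  refine le_trans ?_ (measure_mono hsubset)
  rcases hv with ⟨e, he, hve, hdeg⟩ | hsum
  · have huniv : W e = Set.univ := by
      refine Set.eq_univ_of_forall fun ω e' he' hadj => ?_
      have : e' ∈ (∅ : Finset (Sym2 V)) := by
        rw [← Finset.card_eq_zero.1 hdeg]
        exact Finset.mem_filter.2 ⟨he', hadj⟩
      simp at this
    calc (109 : ENNReal)⁻¹ ≤ 1 := ENNReal.inv_le_one.2 (by norm_num)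
      _ = μ (W e) := by rw [huniv, measure_univ]
      _ ≤ _ := measure_mono (Set.subset_biUnion_of_mem (u := W)
          (Finset.mem_coe.2 (Finset.mem_filter.2 ⟨he, hve⟩)))
  · have hdegle : ∀ e, edgeSetDegE Estar e ≤ n ^ 2 := by
      intro e
      have hcard : Fintype.card (Sym2 V) ≤ n ^ 2 := by
        rw [Sym2.card, Nat.choose_two_right]
        apply Nat.div_le_of_le_mul
        simp only [Nat.add_sub_cancel]
        nlinarith
      exact (Finset.card_le_univ _).trans hcard
    have hwin : ∀ e ∈ Estar, (27 / 109 : ℝ) * (1 / edgeSetDegE Estar e) ≤ μ.real (W e) := by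
      intro e he
      rcases Nat.eq_zero_or_pos (edgeSetDegE Estar e) with h0 | hpos
      · simp [h0]
      · have hprob : ∀ f ∈ Estar, μ.real {ω | z f ω ≤ n ^ 3 / (2 * edgeSetDegE Estar e)} =
            ((n ^ 3 / (2 * edgeSetDegE Estar e) : ℕ) : ℝ) / (n ^ 3 : ℕ) := fun f hf =>
          measureReal_le_of_uniform μ (by positivity) (hmeas f hf) (huniform f hf)
            (Nat.div_le_self _ _)
        refine (threshold_bound hn hpos (hdegle e)).trans
          ((measureReal_strictMin_ge μ z
            (Estar.filter (fun e' => e' ≠ e ∧ ∃ w : V, w ∈ e ∧ w ∈ e')) e _ (hprob e he)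
            (fun f hf => hprob f (Finset.mem_filter.1 hf).1)
            (fun f hf => hindep e he f (Finset.mem_filter.1 hf).1
              (Finset.mem_filter.1 hf).2.1.symm)).trans (le_of_eq ?_))
        simp only [hW, Finset.mem_filter, and_imp]
    have hmeasW : ∀ e ∈ Estar, MeasurableSet (W e) := by
      intro e he
      simp only [hW, Set.ofPred_forall]
      exact Finset.measurableSet_biInter _ fun e' he' => MeasurableSet.iInter fun _ =>
        measurableSet_lt (hmeas e he) (hmeas e' he')
    have hdisj : Set.PairwiseDisjoint (↑(Estar.filter (fun e => v ∈ e))) W := by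
      intro e he f hf hne
      obtain ⟨he, hve⟩ := Finset.mem_filter.1 (Finset.mem_coe.1 he)
      obtain ⟨hf, hvf⟩ := Finset.mem_filter.1 (Finset.mem_coe.1 hf)
      exact Set.disjoint_left.2 fun ω h1 h2 => lt_asymm
        (h1 f hf ⟨hne.symm, v, hve, hvf⟩) (h2 e he ⟨hne, v, hvf, hve⟩)
    have hreal : (1 / 109 : ℝ) ≤ μ.real (⋃ e ∈ Estar.filter (fun e => v ∈ e), W e) := by
      rw [measureReal_biUnion_finset hdisj
        (fun e he => hmeasW e (Finset.mem_filter.1 he).1)]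
      refine le_trans ?_ (Finset.sum_le_sum fun e he => hwin e (Finset.mem_filter.1 he).1)
      rw [← Finset.mul_sum]
      linarith
    rw [← ENNReal.toReal_le_toReal (by simp) (measure_ne_top _ _)]
    simpa [measureReal_def] using hreal
end

section
/- Let G = (V, E) be a finite simple graph with |V| ≤ n, let 0 < δ ≤ 10, and let n be a positive integer with n² ≥ 200/δ. Let J' ⊆ V, let (z_u)_{u ∈ J'} be pairwise independent random variables each uniformly distributed on {1, …, n³}, and define IS_h = {u ∈ J' : z_u < z_w for every w ∈ N(u) ∩ J'}. Let N_v ⊆ J' be a set such that either some u ∈ N_v has d_{J'}(u) = 0, or ∑_{u ∈ N_v} 1/d_{J'}(u) ≥ 0.1·δ. Then P(N_v ∩ IS_h ≠ ∅) ≥ 0.01·δ. -/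
open MeasureTheory ProbabilityTheory

variable {V : Type*} [Fintype V] [DecidableEq V]

/-- `d_U(v)`: the number of neighbors of `v` (in `G`) lying in `U`. -/
def degIn (G : SimpleGraph V) [DecidableRel G.Adj] (U : Finset V) (v : V) : ℕ :=
  ((G.neighborFinset v).filter (fun u => u ∈ U)).card

theorem measureReal_le_eq_div_of_uniform {Ω : Type*} [MeasurableSpace Ω] {μ : Measure Ω}
    [IsProbabilityMeasure μ] {X : Ω → ℕ} (hX : Measurable X) {N : ℕ} (hN : 0 < N)
    (hunif : ∀ j ∈ Finset.Icc 1 N, μ {ω | X ω = j} = (N : ENNReal)⁻¹) {t : ℕ} (ht : t ≤ N) :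
    μ.real {ω | X ω ≤ t} = (t : ℝ) / N := by
  have hsum (s : Finset ℕ) (hs : s ⊆ Finset.Icc 1 N) :
      μ.real (X ⁻¹' (s : Set ℕ)) = (s.card : ℝ) / N := by
    have hcover : X ⁻¹' (s : Set ℕ) = ⋃ j ∈ s, {ω | X ω = j} := by
      ext ω; simp
    rw [hcover, measureReal_biUnion_finset]
    · have hpoint : ∀ j ∈ s, μ.real {ω | X ω = j} = (N : ℝ)⁻¹ := fun j hj => by
        simp [measureReal_def, hunif j (hs hj)]
      rw [Finset.sum_congr rfl hpoint, Finset.sum_const, nsmul_eq_mul, div_eq_mul_inv]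
    · intro i _ j _ hij
      refine Set.disjoint_left.2 fun ω hi hj => hij ?_
      exact hi.symm.trans hj
    · exact fun j _ => hX (measurableSet_singleton j)
  have hN' : (0 : ℝ) < N := by exact_mod_cast hN
  apply le_antisymm
  · have htop := hsum (Finset.Icc (t + 1) N) (Finset.Icc_subset_Icc_left (by omega))
    have hdisj : Disjoint {ω | X ω ≤ t} (X ⁻¹' (Finset.Icc (t + 1) N : Set ℕ)) := by
      refine Set.disjoint_left.2 fun ω h1 h2 => ?_
      simp only [Set.mem_ofPred_eq, Set.mem_preimage, Finset.coe_Icc, Set.mem_Icc] at h1 h2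
      omega
    have hunion := measureReal_union (μ := μ) hdisj (hX (Finset.measurableSet _))
    have hle := measureReal_le_one (μ := μ)
      (s := {ω | X ω ≤ t} ∪ X ⁻¹' (Finset.Icc (t + 1) N : Set ℕ))
    have hcard : ((Finset.Icc (t + 1) N).card : ℝ) = N - t := by
      rw [Nat.card_Icc, Nat.add_sub_add_right, Nat.cast_sub ht]
    rw [hcard, sub_div, div_self hN'.ne'] at htop
    linarith
  · have hlow := hsum (Finset.Icc 1 t) (Finset.Icc_subset_Icc_right ht)
    rw [Nat.card_Icc, Nat.add_sub_cancel] at hlow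
    rw [← hlow]
    refine measureReal_mono fun ω h => ?_
    simp only [Set.mem_preimage, Finset.coe_Icc, Set.mem_Icc] at h
    exact h.2

/-- For pairwise independent labels `z`, a lower bound for the probability that some `u ∈ S` has
a label below those of all elements of `K u`, in terms of thresholds `t u` that a label is at most
with probability `p u`. -/
theorem sum_sub_le_measureReal_exists_lt {ι Ω : Type*} [DecidableEq ι] [MeasurableSpace Ω]
    {μ : Measure Ω} [IsProbabilityMeasure μ] {z : ι → Ω → ℕ} {J S : Finset ι} (hS : S ⊆ J)
    {K : ι → Finset ι} (hKJ : ∀ u ∈ S, K u ⊆ J) (hK : ∀ u ∈ S, u ∉ K u)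
    (hmeas : ∀ u ∈ J, Measurable (z u))
    (hindep : ∀ u ∈ J, ∀ w ∈ J, u ≠ w → IndepFun (z u) (z w) μ)
    {t : ι → ℕ} {p : ι → ℝ}
    (hp : ∀ u ∈ J, ∀ w ∈ S, μ.real {ω | z u ω ≤ t w} = p w) :
    ∑ u ∈ S, p u * (1 - (K u).card * p u - ∑ w ∈ S, p w) ≤
      μ.real {ω | ∃ u ∈ S, ∀ w ∈ K u, z u ω < z w ω} := by
  have hm (u) (hu : u ∈ J) (a : ℕ) : MeasurableSet {ω | z u ω ≤ a} :=
    hmeas u hu measurableSet_Iic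
  have hinter (u) (hu : u ∈ J) (w) (hw : w ∈ J) (huw : u ≠ w) (a b : ℕ) :
      μ.real ({ω | z u ω ≤ a} ∩ {ω | z w ω ≤ b}) =
        μ.real {ω | z u ω ≤ a} * μ.real {ω | z w ω ≤ b} := by
    have h := (hindep u hu w hw huw).measure_inter_preimage_eq_mul (Set.Iic a) (Set.Iic b)
      measurableSet_Iic measurableSet_Iic
    exact (congrArg ENNReal.toReal h).trans ENNReal.toReal_mul
  have hp0 (u) (hu : u ∈ S) : 0 ≤ p u := by
    rw [← hp u (hS hu) u hu]; exact measureReal_nonneg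
  let F : ι → Set Ω := fun u => {ω | z u ω ≤ t u} \
    ((⋃ w ∈ K u, {ω | z w ω ≤ t u}) ∪ ⋃ w ∈ S.erase u, {ω | z w ω ≤ t w})
  have hFm : ∀ u ∈ S, MeasurableSet (F u) := fun u hu =>
    (hm u (hS hu) _).diff <|
      (Finset.measurableSet_biUnion _ fun w hw => hm w (hKJ u hu hw) _).union
        (Finset.measurableSet_biUnion _ fun w hw => hm w (hS (Finset.mem_of_mem_erase hw)) _)
  have hFdisj : (S : Set ι).PairwiseDisjoint F := by
    intro u _ w hw huw
    refine Set.disjoint_left.2 fun ω h1 h2 => h1.2 (Or.inr ?_)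
    exact Set.mem_biUnion (Finset.mem_coe.2 (Finset.mem_erase.2 ⟨huw.symm, hw⟩)) h2.1
  have hFsub : (⋃ u ∈ S, F u) ⊆ {ω | ∃ u ∈ S, ∀ w ∈ K u, z u ω < z w ω} := by
    intro ω hω
    obtain ⟨u, hu, hle, hnot⟩ := Set.mem_iUnion₂.1 hω
    refine ⟨u, hu, fun w hw => lt_of_le_of_lt hle (not_le.1 fun h => hnot (Or.inl ?_))⟩
    exact Set.mem_biUnion (Finset.mem_coe.2 hw) h
  refine le_trans ?_ (measureReal_mono hFsub)
  rw [measureReal_biUnion_finset hFdisj hFm]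
  refine Finset.sum_le_sum fun u hu => ?_
  have hcover : {ω | z u ω ≤ t u} ⊆
      F u ∪ ((⋃ w ∈ K u, {ω | z u ω ≤ t u} ∩ {ω | z w ω ≤ t u}) ∪
        ⋃ w ∈ S.erase u, {ω | z u ω ≤ t u} ∩ {ω | z w ω ≤ t w}) := by
    intro ω hω
    simp only [← Set.inter_iUnion₂, ← Set.inter_union_distrib_left]
    by_cases h : ω ∈ (⋃ w ∈ K u, {ω | z w ω ≤ t u}) ∪ ⋃ w ∈ S.erase u, {ω | z w ω ≤ t w}
    · exact Or.inr ⟨hω, h⟩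
    · exact Or.inl ⟨hω, h⟩
  have hbound := (measureReal_mono (μ := μ) hcover).trans <| (measureReal_union_le _ _).trans <|
    add_le_add_right ((measureReal_union_le _ _).trans <|
      add_le_add (measureReal_biUnion_finset_le _ _) (measureReal_biUnion_finset_le _ _)) _
  have hneighbor : ∑ w ∈ K u, μ.real ({ω | z u ω ≤ t u} ∩ {ω | z w ω ≤ t u}) =
      (K u).card * (p u * p u) := by
    rw [← nsmul_eq_mul, ← Finset.sum_const]
    refine Finset.sum_congr rfl fun w hw => ?_
    rw [hinter u (hS hu) w (hKJ u hu hw) (fun h => hK u hu (h ▸ hw)), hp u (hS hu) u hu,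
      hp w (hKJ u hu hw) u hu]
  have hother : ∑ w ∈ S.erase u, μ.real ({ω | z u ω ≤ t u} ∩ {ω | z w ω ≤ t w}) ≤
      p u * ∑ w ∈ S, p w := by
    rw [Finset.mul_sum]
    refine le_trans (le_of_eq (Finset.sum_congr rfl fun w hw => ?_))
      (Finset.sum_le_sum_of_subset_of_nonneg (Finset.erase_subset u S)
        fun w hw _ => mul_nonneg (hp0 u hu) (hp0 w hw))
    have hwS := Finset.mem_of_mem_erase hw
    rw [hinter u (hS hu) w (hS hwS) (Finset.ne_of_mem_erase hw).symm, hp u (hS hu) u hu,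
      hp w (hS hwS) w hwS]
  rw [hneighbor, hp u (hS hu) u hu] at hbound
  linarith

/-- With pairwise independent labels `z_u` uniform on `{1, …, n³}` and
`IS_h` the set of nodes of `J'` that beat all their neighbors in `J'`, any set `N_v ⊆ J'`
containing a node of `J'`-degree `0`, or with `∑_{u ∈ N_v} 1/d_{J'}(u) ≥ 0.1·δ`,
satisfies `P(N_v ∩ IS_h ≠ ∅) ≥ 0.01·δ`. -/
theorem hit_independent_set_with_constant_probability
    (G : SimpleGraph V) [DecidableRel G.Adj]
    (n : ℕ) (hnpos : 0 < n) (hV : Fintype.card V ≤ n)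
    (δ : ℝ) (hδpos : 0 < δ) (hδle : δ ≤ 10) (hn2 : 200 / δ ≤ (n : ℝ) ^ 2)
    {Ω : Type*} [MeasurableSpace Ω] (μ : Measure Ω) [IsProbabilityMeasure μ]
    (J' : Finset V)
    (z : V → Ω → ℕ)
    (hmeas : ∀ u ∈ J', Measurable (z u))
    (huniform : ∀ u ∈ J', ∀ j ∈ Finset.Icc 1 (n ^ 3),
      μ {ω | z u ω = j} = ((n ^ 3 : ℕ) : ENNReal)⁻¹)
    (hindep : ∀ u ∈ J', ∀ w ∈ J', u ≠ w → IndepFun (z u) (z w) μ)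
    (v : V) (Nv : Finset V) (hNv : Nv ⊆ J')
    (hv : (∃ u ∈ Nv, degIn G J' u = 0) ∨
      0.1 * δ ≤ ∑ u ∈ Nv, 1 / (degIn G J' u : ℝ)) :
    ENNReal.ofReal (0.01 * δ) ≤
      μ {ω | ∃ u ∈ Nv,
          ∀ w ∈ (G.neighborFinset u).filter (fun w => w ∈ J'), z u ω < z w ω} := by
  have hreal : ∀ A : Set Ω, 0.01 * δ ≤ μ.real A → ENNReal.ofReal (0.01 * δ) ≤ μ A :=
    fun A h => ENNReal.ofReal_le_of_le_toReal h
  apply hreal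
  by_cases hzero : ∃ u ∈ Nv, degIn G J' u = 0
  · obtain ⟨u, hu, hd⟩ := hzero
    have huniv : {ω | ∃ u ∈ Nv,
        ∀ w ∈ (G.neighborFinset u).filter (fun w => w ∈ J'), z u ω < z w ω} = Set.univ := by
      refine Set.eq_univ_of_forall fun ω => ⟨u, hu, fun w hw => ?_⟩
      rw [Finset.card_eq_zero.1 hd] at hw
      exact absurd hw (Finset.notMem_empty w)
    rw [huniv, probReal_univ]
    linarith
  have hsum := hv.resolve_left hzero
  push Not at hzero
  have hd1 (u) (hu : u ∈ Nv) : (1 : ℝ) ≤ degIn G J' u := by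
    exact_mod_cast Nat.one_le_iff_ne_zero.2 (hzero u hu)
  set T := ∑ u ∈ Nv, 1 / (degIn G J' u : ℝ) with hT
  have hTpos : 0 < T := by linarith
  set c : ℝ := 0.1 * δ / (4 * T) with hc
  have hc0 : 0 ≤ c := by positivity
  have hc4 : c ≤ 1 / 4 := by
    rw [hc, div_le_iff₀ (by positivity)]; linarith
  have hcT : c * T = δ / 40 := by
    rw [hc]; field_simp; norm_num
  have hn : (0 : ℝ) < n := by exact_mod_cast hnpos
  have hN : (0 : ℝ) < ((n ^ 3 : ℕ) : ℝ) := by positivity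
  let t : V → ℕ := fun u => ⌊c / degIn G J' u * ((n ^ 3 : ℕ) : ℝ)⌋₊
  let p : V → ℝ := fun u => (t u : ℝ) / ((n ^ 3 : ℕ) : ℝ)
  have hp0 (u) : 0 ≤ p u := by positivity
  have hp_le (u) : p u ≤ c / degIn G J' u := by
    rw [div_le_iff₀ hN]
    exact Nat.floor_le (by positivity)
  have hp_ge (u) : c / degIn G J' u - 1 / ((n ^ 3 : ℕ) : ℝ) ≤ p u := by
    have h := (Nat.lt_floor_add_one (c / degIn G J' u * ((n ^ 3 : ℕ) : ℝ))).le
    rw [sub_le_iff_le_add, ← add_div, le_div_iff₀ hN]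
    exact h
  have ht (u) (hu : u ∈ Nv) : t u ≤ n ^ 3 := by
    have h : p u ≤ 1 := (hp_le u).trans ((div_le_self hc0 (hd1 u hu)).trans (by linarith))
    rw [div_le_one hN] at h
    exact_mod_cast h
  have hdp (u) (hu : u ∈ Nv) : degIn G J' u * p u ≤ 1 / 4 := by
    have h := hp_le u
    rw [le_div_iff₀ (by linarith [hd1 u hu])] at h
    linarith
  have hcsum : ∑ u ∈ Nv, c / (degIn G J' u : ℝ) = δ / 40 := by
    rw [← hcT, hT, Finset.mul_sum]
    exact Finset.sum_congr rfl fun u _ => by ring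
  have hsum_le : ∑ u ∈ Nv, p u ≤ δ / 40 :=
    hcsum ▸ Finset.sum_le_sum fun u _ => hp_le u
  have hround : (Nv.card : ℝ) * (1 / ((n ^ 3 : ℕ) : ℝ)) ≤ δ / 200 := by
    have hcard : (Nv.card : ℝ) ≤ n := by exact_mod_cast (Finset.card_le_univ Nv).trans hV
    rw [div_le_iff₀ hδpos] at hn2
    rw [mul_one_div, div_le_iff₀ hN]
    push_cast
    nlinarith [mul_le_mul_of_nonneg_left hn2 hn.le]
  have hsum_ge : δ / 50 ≤ ∑ u ∈ Nv, p u := by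
    have h := Finset.sum_le_sum fun u (_ : u ∈ Nv) => hp_ge u
    rw [Finset.sum_sub_distrib, hcsum, Finset.sum_const, nsmul_eq_mul] at h
    linarith
  have hmain := sum_sub_le_measureReal_exists_lt (μ := μ) (p := p) (t := t) hNv
    (K := fun u => (G.neighborFinset u).filter (fun w => w ∈ J'))
    (fun u _ w hw => (Finset.mem_filter.1 hw).2) (fun u _ hu => by simp at hu) hmeas hindep
    (fun u hu w hw => measureReal_le_eq_div_of_uniform (hmeas u hu) (pow_pos hnpos 3)
      (huniform u hu) (ht w hw))
  refine le_trans ?_ hmain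
  calc 0.01 * δ ≤ ∑ u ∈ Nv, p u * (1 / 2) := by
        rw [← Finset.sum_mul]; linarith
    _ ≤ _ := Finset.sum_le_sum fun u hu => mul_le_mul_of_nonneg_left (by
        have h := hdp u hu
        unfold degIn at h
        linarith) (hp0 u)
end

section
/- Let n ≥ 1 be real and δ > 0 satisfy n^{0.2δ} > 2. Let p, d, a, b be nonnegative integers with p > d, d ≥ n^{13δ}, a ≥ p/(n^{3δ} − n^δ) − p^{0.6}, and b ≤ d/n^{3δ} + d^{0.6}. Then a > b. -/
/-- Expanding `x / (s - y)` to first order in `y` gives a lower bound. -/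
theorem div_add_mul_div_sq_le_div_sub {x y s : ℝ} (hx : 0 ≤ x) (hys : y < s) (hs : 0 < s) :
    x / s + x * y / s ^ 2 ≤ x / (s - y) := by
  rw [le_div_iff₀ (sub_pos.2 hys)]
  have h : (x / s + x * y / s ^ 2) * (s - y) = x - x * y ^ 2 / s ^ 2 := by
    field_simp
    ring
  rw [h]
  have : 0 ≤ x * y ^ 2 / s ^ 2 := by positivity
  linarith

/-- restricted palette exceeds new degree. Let `n ≥ 1` and `δ > 0`
satisfy `n^{0.2δ} > 2`, and let `p, d, a, b` be nonnegative integers with `p > d`,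
`d ≥ n^{13δ}`, `a ≥ p/(n^{3δ} − n^δ) − p^{0.6}` and `b ≤ d/n^{3δ} + d^{0.6}`.
Then `a > b`. -/
theorem restricted_palette_exceeds_degree
    (n δ : ℝ) (hn : 1 ≤ n) (hδ : 0 < δ) (hbig : 2 < n ^ (0.2 * δ))
    (p d a b : ℕ) (hpd : d < p) (hd : n ^ (13 * δ) ≤ (d : ℝ))
    (ha : (p : ℝ) / (n ^ (3 * δ) - n ^ δ) - (p : ℝ) ^ (0.6 : ℝ) ≤ (a : ℝ))
    (hb : (b : ℝ) ≤ (d : ℝ) / n ^ (3 * δ) + (d : ℝ) ^ (0.6 : ℝ)) :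
    b < a := by
  have hn0 : 0 ≤ n := by linarith
  obtain ⟨t, ht⟩ : ∃ t, t = n ^ (0.2 * δ) := ⟨_, rfl⟩
  have hpow (k : ℕ) (e : ℝ) (he : e = 0.2 * δ * k) : n ^ e = t ^ k := by
    rw [he, Real.rpow_mul hn0, Real.rpow_natCast, ht]
  rw [hpow 65 _ (by norm_num; ring)] at hd
  rw [hpow 15 _ (by norm_num; ring), hpow 5 _ (by norm_num; ring)] at ha
  rw [hpow 15 _ (by norm_num; ring)] at hb
  rw [← ht] at hbig
  have ht0 : 0 < t := by linarith
  have hdp : (d : ℝ) < p := by exact_mod_cast hpd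
  have hp0 : (0 : ℝ) < p := (Nat.cast_nonneg d).trans_lt hdp
  have hroot : t ^ 26 ≤ (p : ℝ) ^ (0.4 : ℝ) := by
    have h := Real.rpow_le_rpow (by positivity) (hd.trans hdp.le) (by norm_num : (0 : ℝ) ≤ 0.4)
    rw [← Real.rpow_natCast, ← Real.rpow_mul ht0.le] at h
    norm_num at h ⊢
    exact_mod_cast h
  have hsplit : (p : ℝ) = (p : ℝ) ^ (0.4 : ℝ) * (p : ℝ) ^ (0.6 : ℝ) := by
    rw [← Real.rpow_add hp0]
    norm_num
  have hmain := div_add_mul_div_sq_le_div_sub hp0.le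
    (pow_lt_pow_right₀ (by linarith : 1 < t) (by norm_num : 5 < 15)) (by positivity)
  have hgain : 2 * (p : ℝ) ^ (0.6 : ℝ) ≤ p * t ^ 5 / (t ^ 15) ^ 2 := by
    rw [le_div_iff₀ (by positivity)]
    calc 2 * (p : ℝ) ^ (0.6 : ℝ) * (t ^ 15) ^ 2
        ≤ t * (p : ℝ) ^ (0.6 : ℝ) * (t ^ 15) ^ 2 := by gcongr
      _ = t ^ 26 * (p : ℝ) ^ (0.6 : ℝ) * t ^ 5 := by ring
      _ ≤ (p : ℝ) ^ (0.4 : ℝ) * (p : ℝ) ^ (0.6 : ℝ) * t ^ 5 := by gcongr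
      _ = p * t ^ 5 := by rw [← hsplit]
  have hdiv : (d : ℝ) / t ^ 15 < p / t ^ 15 := by gcongr
  have hrpow : (d : ℝ) ^ (0.6 : ℝ) ≤ (p : ℝ) ^ (0.6 : ℝ) := by gcongr
  have hba : (b : ℝ) < a := by linarith
  exact_mod_cast hba
end
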